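/- arXiv:math/0506047 — 6 statements merged into one kernel-verified Lean document; each statement's English description precedes it below -/
import Mathlib

section
/- Let n ≥ 2 be an integer, and let λ be a real number with λ ≥ n(n−2)/4 such that λ ≠ λ_j for every j ∈ ℕ, where λ_j := ((n−2)/2 + j)(n/2 + j). Then there exists k ∈ ℕ such that the k-th iterate of the map f(λ) := λ + 1 − √(4λ+1) applied to λ is strictly less than n(n−2)/4. -/
/-- In the coordinate `s` with `x = s² − 1/4`, the map `x ↦ x + 1 − √(4x+1)` is the shift
`s ↦ s - 1`, as long as the shifted values stay nonnegative. -/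
theorem iterate_sq_sub_quarter (s : ℝ) (k : ℕ) (hk : (k : ℝ) ≤ s + 1) :
    (fun x : ℝ => x + 1 - Real.sqrt (4 * x + 1))^[k] (s ^ 2 - 1 / 4)
      = (s - k) ^ 2 - 1 / 4 := by
  induction k with
  | zero => simp
  | succ k ih =>
    push_cast at hk ⊢
    have hsqrt : Real.sqrt (4 * ((s - k) ^ 2 - 1 / 4) + 1) = 2 * (s - k) := by
      rw [show 4 * ((s - k) ^ 2 - 1 / 4) + 1 = (2 * (s - k)) ^ 2 by ring]
      exact Real.sqrt_sq (by linarith)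
    rw [Function.iterate_succ_apply', ih (by linarith)]
    simp only [hsqrt]
    ring

/-- If `n ≥ 2`, `λ ≥ n(n−2)/4`, and `λ` is not one of the
`λ_j = ((n−2)/2 + j)(n/2 + j)`, then some iterate of `f(λ) = λ + 1 − √(4λ+1)`
applied to `λ` falls strictly below `n(n−2)/4`. -/
theorem stmt4 (n : ℕ) (hn : 2 ≤ n) (lam : ℝ)
    (hge : (n : ℝ) * ((n : ℝ) - 2) / 4 ≤ lam)
    (hne : ∀ j : ℕ, lam ≠ (((n : ℝ) - 2) / 2 + j) * ((n : ℝ) / 2 + j)) :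
    ∃ k : ℕ, (fun x : ℝ => x + 1 - Real.sqrt (4 * x + 1))^[k] lam
      < (n : ℝ) * ((n : ℝ) - 2) / 4 := by
  have hn' : (2 : ℝ) ≤ n := by exact_mod_cast hn
  obtain ⟨s, hs0, rfl⟩ : ∃ s : ℝ, 0 ≤ s ∧ lam = s ^ 2 - 1 / 4 := by
    refine ⟨Real.sqrt (lam + 1 / 4), Real.sqrt_nonneg _, ?_⟩
    rw [Real.sq_sqrt (by nlinarith)]
    ring
  have hst : 0 ≤ s - ((n : ℝ) - 1) / 2 := by
    have := abs_le_of_sq_le_sq (a := ((n : ℝ) - 1) / 2) (by nlinarith) hs0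
    linarith [le_abs_self (((n : ℝ) - 1) / 2)]
  set m := ⌊s - ((n : ℝ) - 1) / 2⌋₊
  have hle : (m : ℝ) ≤ s - ((n : ℝ) - 1) / 2 := Nat.floor_le hst
  have hlt : s - ((n : ℝ) - 1) / 2 < m + 1 := Nat.lt_floor_add_one _
  have hne_m : (m : ℝ) ≠ s - ((n : ℝ) - 1) / 2 := by
    intro h
    apply hne m
    rw [h]
    ring
  have hlt_m := lt_of_le_of_ne hle hne_m
  refine ⟨m + 1, ?_⟩
  rw [iterate_sq_sub_quarter s (m + 1) (by push_cast; linarith)]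
  push_cast
  have hsq : (s - (m + 1)) ^ 2 < (((n : ℝ) - 1) / 2) ^ 2 :=
    sq_lt_sq' (by linarith) (by linarith)
  linarith
end

section
/- Let n ≥ 1 be an integer and let f : ℝ^{n+1} → ℝ be twice continuously differentiable. For i = 0, …, n and a differentiable function g, define (T_i g)(x) := Dg(x)(x_i·x − e_i), where x_i is the i-th coordinate of x and e_i is the i-th standard basis vector; define (Ef)(x) := Df(x)(x) and Δf(x) := Σ_{i=0}^{n} D²f(x)(e_i, e_i). Then for every x ∈ ℝ^{n+1} with ‖x‖ = 1, Σ_{i=0}^{n} (T_i(T_i f))(x) = Δf(x) − D(Ef)(x)(x) − (n−1)·Df(x)(x). -/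
/-- The conformal vector field `T_i` acting on a function `g` on `ℝ^{n+1}`:
`(T_i g)(x) = Dg(x)(x_i·x − e_i)`. -/
noncomputable def confVF (n : ℕ) (i : Fin (n + 1))
    (g : EuclideanSpace ℝ (Fin (n + 1)) → ℝ) (x : EuclideanSpace ℝ (Fin (n + 1))) : ℝ :=
  fderiv ℝ g x (x i • x - EuclideanSpace.single i 1)

/-- The product rule for the derivative of `f` along a vector field `v`. -/
theorem fderiv_fderiv_apply_vectorField {E : Type*} [NormedAddCommGroup E] [NormedSpace ℝ E]
    {f : E → ℝ} (hf : ContDiff ℝ 2 f) {v : E → E} {v' : E →L[ℝ] E} {x : E}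
    (hv : HasFDerivAt v v' x) (w : E) :
    fderiv ℝ (fun y => fderiv ℝ f y (v y)) x w =
      fderiv ℝ (fderiv ℝ f) x w (v x) + fderiv ℝ f x (v' w) := by
  have hd : DifferentiableAt ℝ (fderiv ℝ f) x :=
    (hf.fderiv_right (m := 1) (by norm_num)).differentiable (by norm_num) x
  rw [(hd.hasFDerivAt.clm_apply hv).fderiv]
  simp [add_comm]

theorem confVF_confVF {n : ℕ} {f : EuclideanSpace ℝ (Fin (n + 1)) → ℝ} (hf : ContDiff ℝ 2 f)
    (i : Fin (n + 1)) (x : EuclideanSpace ℝ (Fin (n + 1))) :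
    confVF n i (confVF n i f) x =
      fderiv ℝ (fderiv ℝ f) x (x i • x - EuclideanSpace.single i 1)
          (x i • x - EuclideanSpace.single i 1)
        + fderiv ℝ f x ((2 * x i ^ 2 - 1) • x - x i • EuclideanSpace.single i 1) := by
  have hv : HasFDerivAt
      (fun y : EuclideanSpace ℝ (Fin (n + 1)) => y i • y - EuclideanSpace.single i (1 : ℝ)) _ x :=
    ((EuclideanSpace.proj (𝕜 := ℝ) i).hasFDerivAt.smul (hasFDerivAt_id x)).sub_const _
  refine (fderiv_fderiv_apply_vectorField hf hv _).trans ?_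
  congr 2
  simp
  module

/-- For `f` twice continuously differentiable on `ℝ^{n+1}` and `‖x‖ = 1`,
`Σ_i (T_i(T_i f))(x) = Δf(x) − D(Ef)(x)(x) − (n−1)·Df(x)(x)`, where `(Ef)(x) = Df(x)(x)`
and `Δf(x) = Σ_i D²f(x)(e_i, e_i)`. -/
theorem stmt5 (n : ℕ) (hn : 1 ≤ n) (f : EuclideanSpace ℝ (Fin (n + 1)) → ℝ)
    (hf : ContDiff ℝ 2 f) (x : EuclideanSpace ℝ (Fin (n + 1))) (hx : ‖x‖ = 1) :
    ∑ i : Fin (n + 1), confVF n i (confVF n i f) x =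
      (∑ i : Fin (n + 1),
        fderiv ℝ (fun y => fderiv ℝ f y (EuclideanSpace.single i 1)) x
          (EuclideanSpace.single i 1))
      - fderiv ℝ (fun y => fderiv ℝ f y y) x x
      - ((n : ℝ) - 1) * fderiv ℝ f x x := by
  have hE := fderiv_fderiv_apply_vectorField hf (hasFDerivAt_id x) x
  have hΔ (e : EuclideanSpace ℝ (Fin (n + 1))) :=
    fderiv_fderiv_apply_vectorField hf (hasFDerivAt_const e x) e
  simp only [id_eq, ContinuousLinearMap.id_apply] at hE
  simp only [zero_apply, map_zero, add_zero] at hΔ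
  simp only [confVF_confVF hf, hE, hΔ]
  have hsq : ∑ i, x i ^ 2 = 1 := by
    rw [← EuclideanSpace.real_norm_sq_eq, hx, one_pow]
  have hsum : ∑ i, x i • EuclideanSpace.single i (1 : ℝ) = x := by
    simpa using (EuclideanSpace.basisFun (Fin (n + 1)) ℝ).sum_repr x
  set L := fderiv ℝ f x
  set B := fderiv ℝ (fderiv ℝ f) x
  have hL : ∑ i, x i * L (EuclideanSpace.single i 1) = L x := by
    conv_rhs => rw [← hsum]
    simp
  have hBr : ∑ i, x i * B x (EuclideanSpace.single i 1) = B x x := by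
    conv_rhs => rw [← hsum, map_sum]
    simp [hsum]
  have hBl : ∑ i, x i * B (EuclideanSpace.single i 1) x = B x x := by
    have h := congrArg (fun y => B y x) hsum
    simpa using h
  calc
    _ = ∑ i, (x i ^ 2 * (B x x + 2 * L x) - x i * B x (EuclideanSpace.single i 1)
          - x i * B (EuclideanSpace.single i 1) x
          + B (EuclideanSpace.single i 1) (EuclideanSpace.single i 1)
          - L x - x i * L (EuclideanSpace.single i 1)) := by
      refine Finset.sum_congr rfl fun i _ => ?_
      simp only [map_sub, map_smul, sub_apply,
        smul_apply, smul_eq_mul]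
      ring
    _ = _ := by
      simp only [Finset.sum_sub_distrib, Finset.sum_add_distrib, ← Finset.sum_mul, hsq, hL, hBr,
        hBl, Finset.sum_const, Finset.card_univ, Fintype.card_fin, nsmul_eq_mul]
      push_cast
      ring
end

section
/- Let n ≥ 1 be an integer, j ∈ ℕ, and let p be a real polynomial in the variables X_0, …, X_n that is homogeneous of degree j and harmonic, i.e. Σ_{i=0}^{n} ∂_i² p = 0. Let f : ℝ^{n+1} → ℝ be the associated polynomial function, and for a differentiable function g define (T_i g)(x) := Dg(x)(x_i·x − e_i). Then for every x ∈ ℝ^{n+1} with ‖x‖ = 1, Σ_{i=0}^{n} (T_i(T_i f))(x) = −j(n−1+j)·f(x). -/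
/-- The Fréchet derivative of a polynomial function on Euclidean space. -/
theorem MvPolynomial.hasFDerivAt_eval_euclidean {ι : Type*} [Fintype ι] (q : MvPolynomial ι ℝ)
    (x : EuclideanSpace ℝ ι) :
    HasFDerivAt (fun y : EuclideanSpace ℝ ι => MvPolynomial.eval (fun i => y i) q)
      (∑ k, MvPolynomial.eval (fun i => x i) (MvPolynomial.pderiv k q) •
        (EuclideanSpace.proj k : EuclideanSpace ℝ ι →L[ℝ] ℝ)) x := by
  classical
  induction q using MvPolynomial.induction_on with
  | C a => simpa using hasFDerivAt_const a x
  | add p q hp hq =>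
    simp only [map_add, add_smul, Finset.sum_add_distrib]
    exact hp.add hq
  | mul_X p i hp =>
    have hX : HasFDerivAt (fun y : EuclideanSpace ℝ ι => y i)
        (EuclideanSpace.proj i : EuclideanSpace ℝ ι →L[ℝ] ℝ) x :=
      (EuclideanSpace.proj i : EuclideanSpace ℝ ι →L[ℝ] ℝ).hasFDerivAt
    simp only [map_mul, MvPolynomial.eval_X]
    refine (hp.mul hX).congr_fderiv ?_
    ext v
    simp [MvPolynomial.pderiv_X, Pi.single_apply, Finset.mul_sum, apply_ite, mul_comm]
    simp [mul_add, Finset.sum_add_distrib, mul_left_comm]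

/-- The conformal vector field `T_i` maps the function of a homogeneous polynomial `q` of degree
`d` to the function of `d X_i q - ∂_i q`. -/
theorem confVF_eval_of_isHomogeneous {n d : ℕ} {q : MvPolynomial (Fin (n + 1)) ℝ}
    (hq : q.IsHomogeneous d) (i : Fin (n + 1)) (x : EuclideanSpace ℝ (Fin (n + 1))) :
    confVF n i (fun y => MvPolynomial.eval (fun k => y k) q) x =
      d * (x i * MvPolynomial.eval (fun k => x k) q) -
        MvPolynomial.eval (fun k => x k) (MvPolynomial.pderiv i q) := by
  have h := congrArg (MvPolynomial.eval (fun k => x k)) hq.sum_X_mul_pderiv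
  simp only [map_sum, map_mul, MvPolynomial.eval_X, map_natCast, nsmul_eq_mul] at h
  rw [confVF, (q.hasFDerivAt_eval_euclidean x).fderiv]
  have : ∑ k, MvPolynomial.eval (fun i => x i) (MvPolynomial.pderiv k q) * (x i * x k) =
      x i * (d * MvPolynomial.eval (fun k => x k) q) := by
    rw [← h, Finset.mul_sum]
    exact Finset.sum_congr rfl fun k _ => by ring
  simp [mul_sub, Finset.sum_sub_distrib, this]
  ring

/-- `T_i` is linear on differentiable functions. -/
theorem confVF_const_mul_sub {n : ℕ} (i : Fin (n + 1)) (c : ℝ)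
    {g h : EuclideanSpace ℝ (Fin (n + 1)) → ℝ} {x : EuclideanSpace ℝ (Fin (n + 1))}
    (hg : DifferentiableAt ℝ g x) (hh : DifferentiableAt ℝ h x) :
    confVF n i (fun y => c * g y - h y) x = c * confVF n i g x - confVF n i h x := by
  simp only [confVF]
  rw [fderiv_fun_sub (hg.const_mul c) hh, fderiv_const_mul hg]
  simp

/-- If `p` is a harmonic polynomial in `X_0, …, X_n`, homogeneous of degree `j`,
with associated polynomial function `f`, then for `‖x‖ = 1`,
`Σ_i (T_i(T_i f))(x) = −j(n−1+j)·f(x)`. -/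
theorem stmt6 (n : ℕ) (hn : 1 ≤ n) (j : ℕ) (p : MvPolynomial (Fin (n + 1)) ℝ)
    (hhom : p.IsHomogeneous j)
    (hharm : ∑ i : Fin (n + 1), MvPolynomial.pderiv i (MvPolynomial.pderiv i p) = 0)
    (f : EuclideanSpace ℝ (Fin (n + 1)) → ℝ)
    (hfp : ∀ x : EuclideanSpace ℝ (Fin (n + 1)), f x = MvPolynomial.eval (fun i => x i) p)
    (x : EuclideanSpace ℝ (Fin (n + 1))) (hx : ‖x‖ = 1) :
    ∑ i : Fin (n + 1), confVF n i (confVF n i f) x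
      = -((j : ℝ) * ((n : ℝ) - 1 + j)) * f x := by
  obtain rfl : f = fun y => MvPolynomial.eval (fun i => y i) p := funext hfp
  have hT (i : Fin (n + 1)) :
      confVF n i (confVF n i fun y => MvPolynomial.eval (fun k => y k) p) x =
        (j : ℝ) * ((j + 1) * (x i ^ 2 * MvPolynomial.eval (fun k => x k) p)) -
        ((j : ℝ) * MvPolynomial.eval (fun k => x k) p) -
        ((j : ℝ) + (j - 1 : ℕ)) *
          (x i * MvPolynomial.eval (fun k => x k) (MvPolynomial.pderiv i p)) +
        MvPolynomial.eval (fun k => x k) (MvPolynomial.pderiv i (MvPolynomial.pderiv i p)) := by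
    have h1 : confVF n i (fun y => MvPolynomial.eval (fun k => y k) p) = fun y =>
        (j : ℝ) * MvPolynomial.eval (fun k => y k) (MvPolynomial.X i * p) -
          MvPolynomial.eval (fun k => y k) (MvPolynomial.pderiv i p) := by
      funext y
      simp [confVF_eval_of_isHomogeneous hhom]
    rw [h1, confVF_const_mul_sub i _
      (MvPolynomial.hasFDerivAt_eval_euclidean _ x).differentiableAt
      (MvPolynomial.hasFDerivAt_eval_euclidean _ x).differentiableAt,
      confVF_eval_of_isHomogeneous ((MvPolynomial.isHomogeneous_X ℝ i).mul hhom),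
      confVF_eval_of_isHomogeneous hhom.pderiv]
    simp only [MvPolynomial.pderiv_mul, MvPolynomial.pderiv_X_self, map_add, map_mul, map_one,
      MvPolynomial.eval_X]
    push_cast
    ring
  have hsq : ∑ i, x i ^ 2 = 1 := by
    rw [← EuclideanSpace.real_norm_sq_eq, hx, one_pow]
  have heuler := congrArg (MvPolynomial.eval (fun k => x k)) hhom.sum_X_mul_pderiv
  have hlap := congrArg (MvPolynomial.eval (fun k => x k)) hharm
  simp only [map_sum, map_mul, MvPolynomial.eval_X, map_natCast, nsmul_eq_mul, map_zero]
    at heuler hlap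
  simp only [hT, Finset.sum_add_distrib, Finset.sum_sub_distrib, ← Finset.mul_sum,
    ← Finset.sum_mul, hsq, heuler, hlap, Finset.sum_const, Finset.card_univ, Fintype.card_fin,
    nsmul_eq_mul]
  cases j <;> push_cast [Nat.add_sub_cancel] <;> ring
end

section
/- Let n ≥ 1 be an integer, j ≥ 1, and let p be a real polynomial in X_0, …, X_n that is homogeneous of degree j and harmonic (Σ_{k=0}^{n} ∂_k² p = 0). Then for each i: (i) the partial derivative ∂_i p is harmonic and homogeneous of degree j − 1; and (ii) the polynomial (n + 2j − 1)·X_i·p − (Σ_{k=0}^{n} X_k²)·∂_i p is harmonic and homogeneous of degree j + 1. Moreover (ii) also holds for j = 0. -/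
open MvPolynomial in
/-- Partial derivatives with respect to different variables commute. -/
theorem MvPolynomial.pderiv_comm_apply {σ R : Type*} [CommRing R] (i k : σ)
    (p : MvPolynomial σ R) : pderiv i (pderiv k p) = pderiv k (pderiv i p) := by
  classical
  let D (l : σ) : Derivation R (MvPolynomial σ R) (MvPolynomial σ R) := pderiv l
  have h : ⁅D i, D k⁆ = 0 := by
    refine derivation_ext fun l => ?_
    rw [Derivation.commutator_apply]
    simp [D, pderiv_X, Pi.single_apply, apply_ite]
  have := DFunLike.congr_fun h p
  rw [Derivation.commutator_apply] at this
  exact sub_eq_zero.mp this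

open MvPolynomial in
/-- Leibniz rule for the Laplacian of `X i * p`. -/
theorem MvPolynomial.sum_pderiv_pderiv_X_mul {σ R : Type*} [Fintype σ] [CommRing R] (i : σ)
    (p : MvPolynomial σ R) :
    ∑ k, pderiv k (pderiv k (X i * p)) =
      2 * pderiv i p + X i * ∑ k, pderiv k (pderiv k p) := by
  classical
  have h (k : σ) : pderiv k (pderiv k (X i * p)) =
      (if k = i then 2 * pderiv k p else 0) + X i * pderiv k (pderiv k p) := by
    by_cases hk : k = i
    · subst hk
      simp
      ring
    · simp [pderiv_X_of_ne (Ne.symm hk), hk]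
  simp_rw [h, Finset.sum_add_distrib, Finset.mul_sum]
  simp

open MvPolynomial in
/-- Leibniz rule for the Laplacian of `(∑ k, X k ^ 2) * q`. -/
theorem MvPolynomial.sum_pderiv_pderiv_sum_X_sq_mul {σ R : Type*} [Fintype σ] [CommRing R]
    (q : MvPolynomial σ R) :
    ∑ k, pderiv k (pderiv k ((∑ l, X l ^ 2) * q)) =
      2 * (Fintype.card σ : MvPolynomial σ R) * q + 4 * ∑ k, X k * pderiv k q
        + (∑ l, X l ^ 2) * ∑ k, pderiv k (pderiv k q) := by
  classical
  have hr (k : σ) : pderiv k (∑ l, X l ^ 2 : MvPolynomial σ R) = 2 * X k := by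
    rw [map_sum, Finset.sum_eq_single k]
    · simp
    · intro l _ hl
      simp [pderiv_X_of_ne hl]
    · simp
  have h2 (k : σ) : pderiv k (2 : MvPolynomial σ R) = 0 := by
    exact (pderiv k).map_natCast 2
  have h (k : σ) : pderiv k (pderiv k ((∑ l, X l ^ 2) * q)) =
      2 * q + 4 * (X k * pderiv k q) + (∑ l, X l ^ 2) * pderiv k (pderiv k q) := by
    simp only [pderiv_mul, map_add, hr, h2, pderiv_X_self]
    ring
  simp only [h, Finset.sum_add_distrib, ← Finset.mul_sum, Finset.sum_const, Finset.card_univ,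
    nsmul_eq_mul]
  ring


open MvPolynomial in
/-- If `p` is harmonic and homogeneous of degree `j` in `X_0, …, X_n`, then
(i) for `j ≥ 1`, each `∂_i p` is harmonic and homogeneous of degree `j − 1`, and
(ii) for every `j` (including `j = 0`), `(n + 2j − 1)·X_i·p − (Σ_k X_k²)·∂_i p` is harmonic
and homogeneous of degree `j + 1`. -/
theorem stmt7 (n : ℕ) (hn : 1 ≤ n) (j : ℕ) (p : MvPolynomial (Fin (n + 1)) ℝ)
    (hhom : p.IsHomogeneous j)
    (hharm : ∑ k : Fin (n + 1), pderiv k (pderiv k p) = 0) :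
    (1 ≤ j → ∀ i : Fin (n + 1),
      (∑ k : Fin (n + 1), pderiv k (pderiv k (pderiv i p)) = 0) ∧
      (pderiv i p).IsHomogeneous (j - 1)) ∧
    (∀ i : Fin (n + 1),
      (∑ k : Fin (n + 1), pderiv k (pderiv k
        (((n : ℝ) + 2 * j - 1) • (X i * p)
          - (∑ k : Fin (n + 1), X k ^ 2) * pderiv i p)) = 0) ∧
      (((n : ℝ) + 2 * j - 1) • (X i * p)
          - (∑ k : Fin (n + 1), X k ^ 2) * pderiv i p).IsHomogeneous (j + 1)) := by
  have hder (i : Fin (n + 1)) : ∑ k : Fin (n + 1), pderiv k (pderiv k (pderiv i p)) = 0 := by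
    simp only [pderiv_comm_apply _ i]
    rw [← map_sum, hharm, map_zero]
  refine ⟨fun _ i => ⟨hder i, hhom.pderiv⟩, fun i => ⟨?_, ?_⟩⟩
  · have heuler : ∑ k, X k * pderiv k (pderiv i p) = ((j : MvPolynomial _ ℝ) - 1) * pderiv i p := by
      rcases j with _ | j
      · obtain ⟨c, rfl⟩ : ∃ c, p = C c :=
          ⟨_, totalDegree_eq_zero_iff_eq_C.mp (Nat.le_zero.mp hhom.totalDegree_le)⟩
        simp
      · have := (hhom.pderiv (i := i)).sum_X_mul_pderiv
        simpa using this
    simp only [map_sub, Derivation.map_smul, Finset.sum_sub_distrib, ← Finset.smul_sum]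
    rw [sum_pderiv_pderiv_X_mul, sum_pderiv_pderiv_sum_X_sq_mul, hharm, hder, heuler,
      smul_eq_C_mul]
    simp [map_ofNat C 2]
    ring
  · refine IsHomogeneous.sub ?_ ?_
    · rw [smul_eq_C_mul]
      rw [add_comm j 1]
      exact ((isHomogeneous_X ℝ i).mul hhom).C_mul _
    · rcases j with _ | j
      · obtain ⟨c, rfl⟩ : ∃ c, p = C c :=
          ⟨_, totalDegree_eq_zero_iff_eq_C.mp (Nat.le_zero.mp hhom.totalDegree_le)⟩
        simpa using isHomogeneous_zero _ _ _
      · have hr : (∑ k : Fin (n + 1), X k ^ 2 : MvPolynomial _ ℝ).IsHomogeneous 2 :=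
          IsHomogeneous.sum _ _ _ fun k _ => isHomogeneous_X_pow k 2
        rw [show j + 1 + 1 = 2 + (j + 1 - 1) by omega]
        exact hr.mul hhom.pderiv
end

section
/- Let m > 0 be a real number and j ∈ ℕ. The function g(r) := Γ(m − r)·Γ(m + j + r) / ( Γ(m + r)·Γ(m + j − r) ) satisfies g(0) = 1 and has derivative at r = 0 equal to 2·Σ_{p=0}^{j−1} 1/(m + p). -/
/-- The logarithmic derivative of `Γ` grows by `1 / s` when passing from `s` to `s + 1`. -/
lemma Real.hasDerivAt_Gamma_add_one {s c : ℝ} (hs : s ≠ 0)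
    (h : HasDerivAt Real.Gamma (Real.Gamma s * c) s) :
    HasDerivAt Real.Gamma (Real.Gamma (s + 1) * (c + 1 / s)) (s + 1) := by
  have hshift : HasDerivAt (fun x : ℝ => x - 1) 1 (s + 1) := (hasDerivAt_id _).sub_const 1
  have hΓ : HasDerivAt (fun x : ℝ => Real.Gamma (x - 1)) (Real.Gamma s * c) (s + 1) := by
    simpa using HasDerivAt.comp_sub_const (s + 1) 1 (by simpa using h)
  have hprod := hshift.mul hΓ
  have hne : ∀ᶠ x in nhds (s + 1), x - 1 ≠ 0 :=
    hshift.continuousAt.eventually_ne (by simpa using hs)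
  refine (hprod.congr_of_eventuallyEq ?_).congr_deriv ?_
  · filter_upwards [hne] with x hx
    simpa using Real.Gamma_add_one hx
  · rw [Real.Gamma_add_one hs]
    simp only [add_sub_cancel_right]
    field_simp
    ring

/-- The logarithmic derivative of `Γ` at `s + j` exceeds the one at `s` by
`∑ p < j, 1 / (s + p)`. -/
lemma Real.hasDerivAt_Gamma_add_natCast {s c : ℝ} (hs : 0 < s)
    (h : HasDerivAt Real.Gamma (Real.Gamma s * c) s) (j : ℕ) :
    HasDerivAt Real.Gamma
      (Real.Gamma (s + j) * (c + ∑ p ∈ Finset.range j, 1 / (s + p))) (s + j) := by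
  induction j with
  | zero => simpa using h
  | succ k ih =>
    have := Real.hasDerivAt_Gamma_add_one (by positivity) ih
    rwa [add_assoc c, ← Finset.sum_range_succ, add_assoc s, ← Nat.cast_succ] at this

/-- For real `m > 0` and `j ∈ ℕ`, the function
`g(r) = Γ(m − r)Γ(m + j + r)/(Γ(m + r)Γ(m + j − r))` satisfies `g(0) = 1` and
`g′(0) = 2·Σ_{p=0}^{j−1} 1/(m + p)`. -/
theorem stmt12 (m : ℝ) (hm : 0 < m) (j : ℕ) (g : ℝ → ℝ)
    (hg : ∀ r : ℝ, g r = Real.Gamma (m - r) * Real.Gamma (m + j + r) /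
      (Real.Gamma (m + r) * Real.Gamma (m + j - r))) :
    g 0 = 1 ∧ HasDerivAt g (2 * ∑ p ∈ Finset.range j, 1 / (m + p)) 0 := by
  have hΓm : Real.Gamma m ≠ 0 := (Real.Gamma_pos_of_pos hm).ne'
  have hΓmj : Real.Gamma (m + j) ≠ 0 := (Real.Gamma_pos_of_pos (by positivity)).ne'
  obtain ⟨c, hc⟩ : ∃ c, HasDerivAt Real.Gamma (Real.Gamma m * c) m := by
    have hdiff : DifferentiableAt ℝ Real.Gamma m := Real.differentiableAt_Gamma fun k hk => by
      have : (0 : ℝ) ≤ k := k.cast_nonneg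
      linarith
    exact ⟨deriv Real.Gamma m / Real.Gamma m, by
      simpa [mul_div_cancel₀, hΓm] using hdiff.hasDerivAt⟩
  have hcj := Real.hasDerivAt_Gamma_add_natCast hm hc j
  set S := ∑ p ∈ Finset.range j, 1 / (m + p)
  refine ⟨by rw [hg]; simp [hΓm, hΓmj], ?_⟩
  have hadd {a d : ℝ} (h : HasDerivAt Real.Gamma d a) :
      HasDerivAt (fun r => Real.Gamma (a + r)) d 0 :=
    HasDerivAt.comp_const_add a 0 (by simpa using h)
  have hsub {a d : ℝ} (h : HasDerivAt Real.Gamma d a) :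
      HasDerivAt (fun r => Real.Gamma (a - r)) (-d) 0 :=
    HasDerivAt.comp_const_sub a 0 (by simpa using h)
  have hquot := ((hsub hc).mul (hadd hcj)).div ((hadd hc).mul (hsub hcj))
    (by simp [hΓm, hΓmj])
  refine (hquot.congr_of_eventuallyEq (.of_forall hg)).congr_deriv ?_
  simp only [Pi.mul_apply, add_zero, sub_zero]
  field_simp
  ring
end

section
/- Let k ∈ ℕ and define α : ℝ → ℝ by α(λ) := ∏_{i=0}^{2k} (λ − k + i) (i.e. α(λ) = (λ−k)(λ−k+1)⋯λ⋯(λ+k−1)(λ+k)). Then for every real λ: (a) α(λ+1)·(λ − k) = α(λ)·(λ + k + 1); (b) α(−λ) = −α(λ); and (c) for each μ ∈ {λ+1, λ−1, −λ}, α(μ)·( μ² − λ² − (2k+1) ) = α(λ)·( μ² − λ² + (2k+1) ). -/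
theorem prod_range_add_one_mul (x : ℝ) (n : ℕ) :
    (∏ i ∈ Finset.range n, (x + 1 + i)) * x = (∏ i ∈ Finset.range n, (x + i)) * (x + n) := by
  rw [← Finset.prod_range_succ (fun i : ℕ => x + (i : ℝ)), Finset.prod_range_succ']
  push_cast
  simp only [add_zero, add_assoc, add_comm (1 : ℝ)]

theorem prod_range_symm_neg (k : ℕ) (x : ℝ) :
    ∏ i ∈ Finset.range (2 * k + 1), (-x - k + i) =
      -∏ i ∈ Finset.range (2 * k + 1), (x - k + i) := by
  have hodd : (-1 : ℝ) ^ (2 * k + 1) = -1 := Odd.neg_one_pow ⟨k, rfl⟩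
  rw [← Finset.prod_range_reflect, ← neg_one_mul (∏ i ∈ _, _), ← hodd,
    ← Finset.card_range (2 * k + 1), ← Finset.prod_const, Finset.card_range,
    ← Finset.prod_mul_distrib]
  refine Finset.prod_congr rfl fun i hi => ?_
  have hi' : i ≤ 2 * k := Nat.lt_succ_iff.mp (Finset.mem_range.mp hi)
  rw [Nat.add_sub_cancel, Nat.cast_sub hi']
  push_cast
  ring

/-- For `k ∈ ℕ` and `α(λ) = (λ−k)(λ−k+1)⋯(λ+k)`, one has
(a) `α(λ+1)(λ − k) = α(λ)(λ + k + 1)`, (b) `α(−λ) = −α(λ)`, and (c) for each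
`μ ∈ {λ+1, λ−1, −λ}`, `α(μ)(μ² − λ² − (2k+1)) = α(λ)(μ² − λ² + (2k+1))`. -/
theorem stmt14 (k : ℕ) (a : ℝ → ℝ)
    (ha : ∀ lam : ℝ, a lam = ∏ i ∈ Finset.range (2 * k + 1), (lam - k + i)) (lam : ℝ) :
    a (lam + 1) * (lam - k) = a lam * (lam + k + 1) ∧
    a (-lam) = -a lam ∧
    (∀ mu : ℝ, mu = lam + 1 ∨ mu = lam - 1 ∨ mu = -lam →
      a mu * (mu ^ 2 - lam ^ 2 - (2 * k + 1)) = a lam * (mu ^ 2 - lam ^ 2 + (2 * k + 1))) := by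
  have shift : ∀ x : ℝ, a (x + 1) * (x - k) = a x * (x + k + 1) := by
    intro x
    have h := prod_range_add_one_mul (x - k) (2 * k + 1)
    rw [ha, ha, show x + 1 - (k : ℝ) = x - k + 1 by ring, h]
    push_cast
    ring
  have odd : a (-lam) = -a lam := by
    rw [ha, ha, prod_range_symm_neg]
  refine ⟨shift lam, odd, ?_⟩
  rintro mu (rfl | rfl | rfl)
  · linear_combination 2 * shift lam
  · have h := shift (lam - 1)
    rw [sub_add_cancel] at h
    linear_combination 2 * h
  · rw [odd]
    ring
end
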